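/- Let γ ∈ ℝ, r* > 0, T > 0, and let (Ỹ₁, Ỹ₂) : [0, T] → (ℝ²)² be C¹ with Ỹ₁(t) ≠ Ỹ₂(t) for all t, satisfying dỸ₁/dt = (γ/(2π))·(Ỹ₁ − Ỹ₂)^⊥/|Ỹ₁ − Ỹ₂|² − (γ/(4π(r*)²))·Ỹ_{1,r}·e_z and dỸ₂/dt = (γ/(2π))·(Ỹ₂ − Ỹ₁)^⊥/|Ỹ₂ − Ỹ₁|² − (γ/(4π(r*)²))·Ỹ_{2,r}·e_z. Then the sum of radial components Ỹ_{1,r}(t) + Ỹ_{2,r}(t) is constant on [0, T]; and if moreover Ỹ_{1,r}(0) + Ỹ_{2,r}(0) = 0, then Ỹ₁(t) + Ỹ₂(t) = Ỹ₁(0) + Ỹ₂(0) for all t ∈ [0, T] (the center of mass does not move). -/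

import Mathlib

/-- Counterclockwise rotation by `π/2`: for `a = (a_z, a_r)`, `a^⊥ = (−a_r, a_z)`.
Points of `ℝ²` are written with coordinate `0` the `z`-coordinate and
coordinate `1` the `r`-coordinate. -/
noncomputable def perp (a : EuclideanSpace ℝ (Fin 2)) : EuclideanSpace ℝ (Fin 2) :=
  (WithLp.equiv 2 (Fin 2 → ℝ)).symm ![-(a 1), a 0]

/-- The unit vector `e_z = (1, 0)`. -/
noncomputable def ez : EuclideanSpace ℝ (Fin 2) :=
  (WithLp.equiv 2 (Fin 2 → ℝ)).symm ![1, 0]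

theorem perp_neg (a : EuclideanSpace ℝ (Fin 2)) : perp (-a) = -perp a := by
  ext i
  fin_cases i <;> simp [perp]

theorem ez_apply_one : ez 1 = 0 := by
  simp [ez]

theorem eq_of_hasDerivWithinAt_zero {E : Type*} [NormedAddCommGroup E] [NormedSpace ℝ E]
    {f : ℝ → E} {s : Set ℝ} (hs : Convex ℝ s) (hf : ∀ t ∈ s, HasDerivWithinAt f 0 s t)
    {a b : ℝ} (ha : a ∈ s) (hb : b ∈ s) : f b = f a := by
  have h := hs.norm_image_sub_le_of_norm_hasDerivWithin_le (C := 0) hf (by simp) ha hb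
  rw [zero_mul] at h
  exact sub_eq_zero.mp (norm_le_zero_iff.mp h)

/-- For the two-ring limiting leapfrogging system, the sum of the radial components
`Ỹ_{1,r} + Ỹ_{2,r}` is conserved; if moreover it vanishes initially, then the center of
mass `Ỹ₁ + Ỹ₂` does not move at all. -/
theorem stmt_17 (γ rstar T : ℝ) (hr : 0 < rstar) (hT : 0 < T)
    (Y₁ Y₂ : ℝ → EuclideanSpace ℝ (Fin 2))
    (hsep : ∀ t ∈ Set.Icc (0:ℝ) T, Y₁ t ≠ Y₂ t)
    (h1 : ∀ t ∈ Set.Icc (0:ℝ) T,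
      HasDerivWithinAt Y₁
        ((γ/(2*Real.pi)) • ((‖Y₁ t - Y₂ t‖^2)⁻¹ • perp (Y₁ t - Y₂ t))
          - (γ/(4*Real.pi*rstar^2) * Y₁ t 1) • ez)
        (Set.Icc 0 T) t)
    (h2 : ∀ t ∈ Set.Icc (0:ℝ) T,
      HasDerivWithinAt Y₂
        ((γ/(2*Real.pi)) • ((‖Y₂ t - Y₁ t‖^2)⁻¹ • perp (Y₂ t - Y₁ t))
          - (γ/(4*Real.pi*rstar^2) * Y₂ t 1) • ez)
        (Set.Icc 0 T) t) :
    (∀ t ∈ Set.Icc (0:ℝ) T, Y₁ t 1 + Y₂ t 1 = Y₁ 0 1 + Y₂ 0 1) ∧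
    (Y₁ 0 1 + Y₂ 0 1 = 0 →
      ∀ t ∈ Set.Icc (0:ℝ) T, Y₁ t + Y₂ t = Y₁ 0 + Y₂ 0) := by
  have h0 : (0 : ℝ) ∈ Set.Icc (0 : ℝ) T := Set.left_mem_Icc.mpr hT.le
  have hsum : ∀ t ∈ Set.Icc (0 : ℝ) T, HasDerivWithinAt (fun s => Y₁ s + Y₂ s)
      (-(γ / (4 * Real.pi * rstar ^ 2) * (Y₁ t 1 + Y₂ t 1)) • ez) (Set.Icc 0 T) t := by
    intro t ht
    refine ((h1 t ht).add (h2 t ht)).congr_deriv ?_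
    rw [← neg_sub (Y₁ t) (Y₂ t), perp_neg, norm_neg]
    module
  have hradial : ∀ t ∈ Set.Icc (0 : ℝ) T, Y₁ t 1 + Y₂ t 1 = Y₁ 0 1 + Y₂ 0 1 := by
    intro t ht
    refine eq_of_hasDerivWithinAt_zero (f := fun s => Y₁ s 1 + Y₂ s 1)
      (convex_Icc 0 T) (fun s hs => ?_) h0 ht
    have h := (EuclideanSpace.proj (𝕜 := ℝ) (1 : Fin 2)).hasFDerivAt.comp_hasDerivWithinAt s
      (hsum s hs)
    exact h.congr_deriv (by simp [ez_apply_one])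
  refine ⟨hradial, fun hzero t ht => ?_⟩
  refine eq_of_hasDerivWithinAt_zero (f := fun s => Y₁ s + Y₂ s)
    (convex_Icc 0 T) (fun s hs => ?_) h0 ht
  exact (hsum s hs).congr_deriv (by rw [hradial s hs, hzero]; simp)
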